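/- arXiv:1507.02421 — 2 statements merged into one kernel-verified Lean document; each statement's English description precedes it below -/
import Mathlib

section
/- Let G be a commutative monoid (written multiplicatively) with decidable equality, let q ∈ G, let r, s, m be natural numbers with r ≥ 1, let t : Fin s → ℕ satisfy t i ≤ r for all i, and suppose that the number of indices i with t i = r is at least m. Let χ : Fin s → G and define the multiset V := ∑_{i : Fin s} (Multiset.range (t i)).map (fun k => χ i * q ^ k), i.e. V is the disjoint union of the geometric progressions χ i, χ i · q, …, χ i · q^{t i − 1}. Then m ≤ Multiset.card (V ∩ V.map (fun x => q ^ (r − 1) * x)). (This is the eigenvalue count underlying Lemma 3.2.2: a multiset that is a union of geometric progressions of ratio q and lengths at most r, at least m of which have length exactly r, meets its translate by q^{r−1} in a multiset of cardinality at least m.) -/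
/-- A multiset `V` that is a disjoint union of geometric progressions of ratio `q`
and lengths `t i ≤ r`, at least `m` of which have length exactly `r`, meets its
translate by `q ^ (r - 1)` in a multiset of cardinality at least `m`. -/
theorem raising_level_eigenvalue_count {G : Type*} [CommMonoid G] [DecidableEq G]
    (q : G) (r s m : ℕ) (hr : 1 ≤ r) (t : Fin s → ℕ) (ht : ∀ i, t i ≤ r)
    (hm : m ≤ (Finset.univ.filter fun i => t i = r).card) (χ : Fin s → G) :
    m ≤ Multiset.card
      ((∑ i : Fin s, (Multiset.range (t i)).map fun k => χ i * q ^ k) ∩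
        (∑ i : Fin s, (Multiset.range (t i)).map fun k => χ i * q ^ k).map
          fun x => q ^ (r - 1) * x) := by
  classical
  set S := Finset.univ.filter fun i => t i = r with hS
  set V := ∑ i : Fin s, (Multiset.range (t i)).map fun k => χ i * q ^ k with hV
  have key : ∀ k < r, ∑ i ∈ S, ({χ i * q ^ k} : Multiset G) ≤ V := by
    intro k hk
    calc ∑ i ∈ S, ({χ i * q ^ k} : Multiset G)
        ≤ ∑ i ∈ S, (Multiset.range (t i)).map fun k => χ i * q ^ k := by
          refine Finset.sum_le_sum fun i hi => ?_
          rw [Multiset.singleton_le]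
          have h : t i = r := (Finset.mem_filter.mp hi).2
          exact Multiset.mem_map.mpr ⟨k, Multiset.mem_range.mpr (h ▸ hk), rfl⟩
      _ ≤ V := Finset.sum_le_sum_of_subset (Finset.subset_univ S)
  have h1 := key (r - 1) (by omega)
  have h2 := Multiset.map_le_map (f := fun x => q ^ (r - 1) * x) (key 0 (by omega))
  have h3 : (∑ i ∈ S, ({χ i * q ^ 0} : Multiset G)).map (fun x => q ^ (r - 1) * x)
      = ∑ i ∈ S, ({χ i * q ^ (r - 1)} : Multiset G) := by
    rw [← Multiset.coe_mapAddMonoidHom, map_sum]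
    refine Finset.sum_congr rfl fun i _ => ?_
    simp [mul_comm]
  rw [h3] at h2
  have h4 := Multiset.card_le_card (Multiset.le_inter h1 h2)
  rw [Multiset.card_sum] at h4
  simp only [Multiset.card_singleton, Finset.sum_const, smul_eq_mul, mul_one] at h4
  exact hm.trans h4
end

section
/- Let M and N be commutative monoids with decidable equality, let φ : M →* N be a monoid homomorphism, let c ∈ M, let V be a multiset over M, and let m be a natural number. Suppose that Multiset.card ((V.map φ) ∩ (V.map φ).map (fun y => φ c * y)) ≤ m and that m ≤ Multiset.card (V ∩ V.map (fun x => c * x)). Then (V ∩ V.map (fun x => c * x)).map φ = (V.map φ) ∩ (V.map φ).map (fun y => φ c * y), and both multisets have cardinality exactly m. (This is Lemma 3.2.3 of the paper in abstract form: if the multiset V of Frobenius eigenvalues in characteristic zero satisfies card(V ∩ cV) ≥ m while its reduction V̄ = φ(V) satisfies card(V̄ ∩ φ(c)V̄) ≤ m, then V̄ ∩ φ(c)V̄ is exactly the reduction of V ∩ cV.) -/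
/-- Abstract form of Lemma 3.2.3: if `card (V ∩ cV) ≥ m` while the reduction
`V̄ = φ(V)` satisfies `card (V̄ ∩ φ(c) V̄) ≤ m`, then `V̄ ∩ φ(c) V̄` is exactly the
reduction of `V ∩ cV`, and both have cardinality `m`. -/
theorem reduction_of_inter_translate {M N : Type*} [CommMonoid M] [CommMonoid N]
    [DecidableEq M] [DecidableEq N] (φ : M →* N) (c : M) (V : Multiset M) (m : ℕ)
    (h1 : Multiset.card ((V.map ⇑φ) ∩ (V.map ⇑φ).map fun y => φ c * y) ≤ m)
    (h2 : m ≤ Multiset.card (V ∩ V.map fun x => c * x)) :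
    (V ∩ V.map fun x => c * x).map ⇑φ = (V.map ⇑φ) ∩ (V.map ⇑φ).map (fun y => φ c * y) ∧
      Multiset.card ((V ∩ V.map fun x => c * x).map ⇑φ) = m ∧
      Multiset.card ((V.map ⇑φ) ∩ (V.map ⇑φ).map fun y => φ c * y) = m := by
  have key : (V.map fun x => c * x).map ⇑φ = (V.map ⇑φ).map (fun y => φ c * y) := by
    simp only [Multiset.map_map, Function.comp_def, map_mul]
  have hle : (V ∩ V.map fun x => c * x).map ⇑φ ≤
      (V.map ⇑φ) ∩ (V.map ⇑φ).map (fun y => φ c * y) := by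
    refine Multiset.le_inter (Multiset.map_le_map Multiset.inter_le_left) ?_
    rw [← key]
    exact Multiset.map_le_map Multiset.inter_le_right
  have hc := Multiset.card_map ⇑φ (V ∩ V.map fun x => c * x)
  have heq := Multiset.eq_of_le_of_card_le hle (by rw [hc]; exact h1.trans h2)
  have h3 : Multiset.card ((V ∩ V.map fun x => c * x).map ⇑φ) = m :=
    le_antisymm ((Multiset.card_le_card hle).trans h1) (by rw [hc]; exact h2)
  exact ⟨heq, h3, by rw [← heq]; exact h3⟩
end
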